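/- For every π ∈ Sₙ, the set T_π = {(U₁P_πtU₂⁻¹, U₂sP_π⁻¹U₁⁻¹) : U₁, U₂ ∈ N₊, s, t invertible diagonal} is Zariski dense in E_π; that is, 𝕀(T_π) = 𝕀(E_π). -/

import Mathlib

noncomputable section

/-- Pairs of `n × n` complex matrices are points of `ℂ^{2n²}`. -/
abbrev MatC (n : ℕ) := Matrix (Fin n) (Fin n) ℂ

/-- The polynomial ring `R = ℂ[x_{ij}, y_{ij}]` in `2n²` variables. -/
abbrev PolyRing (n : ℕ) := MvPolynomial ((Fin n × Fin n) ⊕ (Fin n × Fin n)) ℂ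

/-- Evaluation of a polynomial at a point `(X, Y)` of `ℂ^{2n²}`. -/
def evalPt (n : ℕ) (p : MatC n × MatC n) : PolyRing n →+* ℂ :=
  MvPolynomial.eval (Sum.elim (fun q => p.1 q.1 q.2) (fun q => p.2 q.1 q.2))

/-- The vanishing ideal `𝕀(S)` of a subset `S ⊆ ℂ^{2n²}`. -/
def vanishingIdeal (n : ℕ) (S : Set (MatC n × MatC n)) : Ideal (PolyRing n) :=
  ⨅ p ∈ S, RingHom.ker (evalPt n p)

/-- `M` is upper triangular: `M_{ij} = 0` for `i > j`. -/
def IsUpperTri {n : ℕ} (M : MatC n) : Prop := ∀ i j : Fin n, j < i → M i j = 0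

/-- The permutation matrix `P_π`, with `(P_π)_{ij} = 1` iff `j = π(i)`. -/
def permMat {n : ℕ} (π : Equiv.Perm (Fin n)) : MatC n :=
  Matrix.of fun i j => if π i = j then 1 else 0

/-- The stratum `E_π = {(X,Y) : X ∈ B₊P_πB₊, XY and YX upper triangular}`. -/
def Epi {n : ℕ} (π : Equiv.Perm (Fin n)) : Set (MatC n × MatC n) :=
  { p | (∃ B₁ B₂ : MatC n, IsUnit B₁ ∧ IsUpperTri B₁ ∧ IsUnit B₂ ∧ IsUpperTri B₂ ∧
          p.1 = B₁ * permMat π * B₂) ∧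
        IsUpperTri (p.1 * p.2) ∧ IsUpperTri (p.2 * p.1) }

/-- The column vector `w` with `w j = 1` solving `A w = A j j • w` by back substitution. -/
def backSubst {n : ℕ} (A : MatC n) (j : Fin n) (i : Fin n) : ℂ :=
  if i = j then 1
  else (∑ k : {k : Fin n // i < k}, A i k.1 * backSubst A j k.1) / (A j j - A i i)
termination_by n - i.1
decreasing_by
  have h1 := k.2
  have h2 := k.1.isLt
  rw [Fin.lt_def] at h1
  omega

theorem backSubst_self {n : ℕ} (A : MatC n) (j : Fin n) : backSubst A j j = 1 := by
  rw [backSubst]; simp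

theorem backSubst_of_ne {n : ℕ} (A : MatC n) {i j : Fin n} (h : i ≠ j) :
    backSubst A j i =
      (∑ k : {k : Fin n // i < k}, A i k.1 * backSubst A j k.1) / (A j j - A i i) := by
  rw [backSubst]; simp [h]

theorem rel_of_backSubst_ne_zero {n : ℕ} {A : MatC n} {r : Fin n → Fin n → Prop}
    (hrefl : ∀ i, r i i) (htrans : ∀ i j k, r i j → r j k → r i k)
    (hA : ∀ i j, A i j ≠ 0 → r i j) (j i : Fin n) (h : backSubst A j i ≠ 0) : r i j := by
  induction i using WellFoundedGT.induction with
  | ind i ih =>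
    by_cases hij : i = j
    · exact hij ▸ hrefl i
    · rw [backSubst_of_ne A hij] at h
      obtain ⟨k, -, hk⟩ := Finset.exists_ne_zero_of_sum_ne_zero (div_ne_zero_iff.mp h).1
      exact htrans _ _ _ (hA _ _ (mul_ne_zero_iff.mp hk).1)
        (ih k.1 k.2 (mul_ne_zero_iff.mp hk).2)

/-- A matrix supported on a suborder of `≤` with distinct diagonal entries is diagonalized by a
unipotent matrix supported on the same suborder. -/
theorem exists_unipotent_mul_diagonal {n : ℕ} {A : MatC n} {r : Fin n → Fin n → Prop}
    (hrefl : ∀ i, r i i) (htrans : ∀ i j k, r i j → r j k → r i k) (hle : ∀ i j, r i j → i ≤ j)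
    (hA : ∀ i j, A i j ≠ 0 → r i j) (hd : Function.Injective fun i => A i i) :
    ∃ W : MatC n, (∀ i, W i i = 1) ∧ (∀ i j, W i j ≠ 0 → r i j) ∧
      A * W = W * Matrix.diagonal fun i => A i i := by
  have hW := rel_of_backSubst_ne_zero hrefl htrans hA
  refine ⟨Matrix.of fun i j => backSubst A j i, fun i => backSubst_self A i,
    fun i j h => hW j i h, ?_⟩
  ext i j
  rw [Matrix.mul_diagonal, Matrix.mul_apply]
  simp only [Matrix.of_apply]
  have hsplit : ∑ k, A i k * backSubst A j k =
      A i i * backSubst A j i + ∑ k : {k : Fin n // i < k}, A i k.1 * backSubst A j k.1 := by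
    rw [← Finset.add_sum_erase _ _ (Finset.mem_univ i)]
    congr 1
    rw [← Finset.sum_subtype (Finset.univ.filter fun k => i < k) (by simp)
      (fun k => A i k * backSubst A j k)]
    refine (Finset.sum_subset (fun k hk => ?_) fun k hk hk' => ?_).symm
    · simpa using (Finset.mem_filter.mp hk).2.ne'
    · have hki : ¬ i ≤ k := fun h =>
        hk' (by simpa using lt_of_le_of_ne h (Finset.ne_of_mem_erase hk).symm)
      rw [not_imp_comm.mp (hA i k) fun h => hki (hle _ _ h), zero_mul]
  rw [hsplit]
  by_cases hij : i = j
  · subst hij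
    rw [Finset.sum_eq_zero, add_zero, mul_comm]
    intro k _
    rw [mul_eq_zero]
    right
    by_contra hk
    exact absurd (hle _ _ (hW _ _ hk)) (not_le.mpr k.2)
  · have hne : A j j - A i i ≠ 0 := sub_ne_zero.mpr fun h => hij (hd h.symm)
    have := backSubst_of_ne A hij
    rw [eq_div_iff hne] at this
    rw [← this]
    ring

theorem permMat_mul {n : ℕ} (π : Equiv.Perm (Fin n)) (M : MatC n) :
    permMat π * M = M.submatrix π id := by
  ext i j
  simp [permMat, Matrix.mul_apply]

theorem mul_permMat {n : ℕ} (π : Equiv.Perm (Fin n)) (M : MatC n) :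
    M * permMat π = M.submatrix id π.symm := by
  ext i j
  simp [permMat, Matrix.mul_apply, ← Equiv.eq_symm_apply]

theorem permMat_mul_inv {n : ℕ} (π : Equiv.Perm (Fin n)) : permMat π * permMat π⁻¹ = 1 := by
  rw [permMat_mul]
  ext i j
  simp [permMat, Matrix.one_apply]

theorem permMat_inv_mul {n : ℕ} (π : Equiv.Perm (Fin n)) : permMat π⁻¹ * permMat π = 1 := by
  simpa using permMat_mul_inv π⁻¹

theorem permMat_mul_diagonal {n : ℕ} (π : Equiv.Perm (Fin n)) (d : Fin n → ℂ) :
    permMat π * Matrix.diagonal d = Matrix.diagonal (d ∘ π) * permMat π := by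
  rw [permMat_mul, mul_permMat]
  ext i j
  simp [Matrix.diagonal_apply, Equiv.eq_symm_apply]

theorem diagonal_pi_mul {n : ℕ} (d e : Fin n → ℂ) :
    Matrix.diagonal (d * e) = Matrix.diagonal d * Matrix.diagonal e :=
  (Matrix.diagonal_mul_diagonal d e).symm

theorem isUpperTri_iff_blockTriangular {n : ℕ} {M : MatC n} :
    IsUpperTri M ↔ M.BlockTriangular id :=
  ⟨fun h _ _ hij => h _ _ hij, fun h _ _ hij => h hij⟩

theorem IsUpperTri.mul {n : ℕ} {M N : MatC n} (hM : IsUpperTri M) (hN : IsUpperTri N) :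
    IsUpperTri (M * N) :=
  isUpperTri_iff_blockTriangular.mpr
    ((isUpperTri_iff_blockTriangular.mp hM).mul (isUpperTri_iff_blockTriangular.mp hN))

theorem isUpperTri_diagonal {n : ℕ} (d : Fin n → ℂ) : IsUpperTri (Matrix.diagonal d) :=
  isUpperTri_iff_blockTriangular.mpr (Matrix.blockTriangular_diagonal d)

theorem IsUpperTri.det_eq {n : ℕ} {M : MatC n} (hM : IsUpperTri M) : M.det = ∏ i, M i i :=
  Matrix.det_of_isUpperTriangular (isUpperTri_iff_blockTriangular.mp hM)

theorem IsUpperTri.isUnit_iff {n : ℕ} {M : MatC n} (hM : IsUpperTri M) :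
    IsUnit M ↔ ∀ i, M i i ≠ 0 := by
  rw [Matrix.isUnit_iff_isUnit_det, hM.det_eq, isUnit_iff_ne_zero, Finset.prod_ne_zero_iff]
  simp

theorem IsUpperTri.inv {n : ℕ} {M : MatC n} (hM : IsUpperTri M) (hu : IsUnit M) :
    IsUpperTri M⁻¹ := by
  have := hu.invertible
  exact isUpperTri_iff_blockTriangular.mpr
    (Matrix.blockTriangular_inv_of_blockTriangular (isUpperTri_iff_blockTriangular.mp hM))

theorem Matrix.inv_mul_of_isUnit {n : ℕ} {M : MatC n} (hu : IsUnit M) : M⁻¹ * M = 1 :=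
  Matrix.nonsing_inv_mul _ ((Matrix.isUnit_iff_isUnit_det _).mp hu)

theorem Matrix.mul_inv_of_isUnit {n : ℕ} {M : MatC n} (hu : IsUnit M) : M * M⁻¹ = 1 :=
  Matrix.mul_nonsing_inv _ ((Matrix.isUnit_iff_isUnit_det _).mp hu)

/-- An invertible upper triangular matrix is a unipotent one times a diagonal one. -/
theorem IsUpperTri.exists_unipotent_diagonal {n : ℕ} {C : MatC n} (hC : IsUpperTri C)
    (hu : IsUnit C) : ∃ (U : MatC n) (d : Fin n → ℂ), IsUpperTri U ∧ (∀ i, U i i = 1) ∧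
      (∀ i, d i ≠ 0) ∧ C = U * Matrix.diagonal d := by
  have h0 := hC.isUnit_iff.mp hu
  refine ⟨C * Matrix.diagonal fun i => (C i i)⁻¹, fun i => C i i,
    hC.mul (isUpperTri_diagonal _), fun i => ?_, h0, ?_⟩
  · rw [Matrix.mul_diagonal, mul_inv_cancel₀ (h0 i)]
  · rw [Matrix.mul_assoc, Matrix.diagonal_mul_diagonal]
    simp [h0]

/-- The torus family `T_π`. -/
def torusFamily {n : ℕ} (π : Equiv.Perm (Fin n)) : Set (MatC n × MatC n) :=
  { p : MatC n × MatC n | ∃ (U₁ U₂ : MatC n) (ds dt : Fin n → ℂ),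
      IsUpperTri U₁ ∧ (∀ i, U₁ i i = 1) ∧
      IsUpperTri U₂ ∧ (∀ i, U₂ i i = 1) ∧
      (∀ i, ds i ≠ 0) ∧ (∀ i, dt i ≠ 0) ∧
      p = (U₁ * permMat π * Matrix.diagonal dt * U₂⁻¹,
           U₂ * Matrix.diagonal ds * permMat π⁻¹ * U₁⁻¹) }

theorem torusFamily_subset_Epi {n : ℕ} (π : Equiv.Perm (Fin n)) : torusFamily π ⊆ Epi π := by
  rintro _ ⟨U₁, U₂, ds, dt, h₁, h₁', h₂, h₂', hs, ht, rfl⟩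
  have u₁ : IsUnit U₁ := h₁.isUnit_iff.mpr fun i => by simp [h₁']
  have u₂ : IsUnit U₂ := h₂.isUnit_iff.mpr fun i => by simp [h₂']
  refine ⟨⟨U₁, Matrix.diagonal dt * U₂⁻¹, u₁, h₁, ?_, (isUpperTri_diagonal _).mul (h₂.inv u₂),
    by simp only [Matrix.mul_assoc]⟩, ?_, ?_⟩
  · refine IsUnit.mul ?_ (Matrix.isUnit_nonsing_inv_iff.mpr u₂)
    exact (isUpperTri_diagonal _).isUnit_iff.mpr fun i => by simpa using ht i
  · have : U₁ * permMat π * Matrix.diagonal dt * U₂⁻¹ *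
        (U₂ * Matrix.diagonal ds * permMat π⁻¹ * U₁⁻¹) =
        U₁ * Matrix.diagonal ((dt * ds) ∘ π) * U₁⁻¹ := by
      calc _ = U₁ * (permMat π * (Matrix.diagonal dt * (U₂⁻¹ * U₂) * Matrix.diagonal ds)) *
            permMat π⁻¹ * U₁⁻¹ := by simp only [Matrix.mul_assoc]
        _ = U₁ * Matrix.diagonal ((dt * ds) ∘ π) * (permMat π * permMat π⁻¹) * U₁⁻¹ := by
          rw [Matrix.inv_mul_of_isUnit u₂, Matrix.mul_one, ← diagonal_pi_mul,
            permMat_mul_diagonal]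
          simp only [Matrix.mul_assoc]
        _ = _ := by rw [permMat_mul_inv, Matrix.mul_one]
    exact this ▸ (h₁.mul (isUpperTri_diagonal _)).mul (h₁.inv u₁)
  · have : U₂ * Matrix.diagonal ds * permMat π⁻¹ * U₁⁻¹ *
        (U₁ * permMat π * Matrix.diagonal dt * U₂⁻¹) =
        U₂ * Matrix.diagonal ds * Matrix.diagonal dt * U₂⁻¹ := by
      calc _ = U₂ * Matrix.diagonal ds * (permMat π⁻¹ * (U₁⁻¹ * U₁) * permMat π) *
            Matrix.diagonal dt * U₂⁻¹ := by simp only [Matrix.mul_assoc]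
        _ = _ := by
          rw [Matrix.inv_mul_of_isUnit u₁, Matrix.mul_one, permMat_inv_mul, Matrix.mul_one]
    exact this ▸ ((h₂.mul (isUpperTri_diagonal _)).mul (isUpperTri_diagonal _)).mul (h₂.inv u₂)

theorem mem_torusFamily_of_borel {n : ℕ} (π : Equiv.Perm (Fin n)) {C₁ C₂ : MatC n}
    (h₁ : IsUpperTri C₁) (u₁ : IsUnit C₁) (h₂ : IsUpperTri C₂) (u₂ : IsUnit C₂) {d : Fin n → ℂ}
    (hd : ∀ i, d i ≠ 0) :
    (C₁ * permMat π * C₂⁻¹, C₂ * permMat π⁻¹ * Matrix.diagonal d * C₁⁻¹) ∈ torusFamily π := by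
  obtain ⟨U₁, d₁, hU₁, hU₁', hd₁, rfl⟩ := h₁.exists_unipotent_diagonal u₁
  obtain ⟨U₂, d₂, hU₂, hU₂', hd₂, rfl⟩ := h₂.exists_unipotent_diagonal u₂
  have hinv : ∀ e : Fin n → ℂ, (∀ i, e i ≠ 0) →
      (Matrix.diagonal e)⁻¹ = Matrix.diagonal e⁻¹ := fun e he =>
    Matrix.inv_eq_right_inv (by simp [Matrix.diagonal_mul_diagonal, he])
  refine ⟨U₁, U₂, d₂ * ((d * d₁⁻¹) ∘ π.symm), (d₁ ∘ π.symm) * d₂⁻¹, hU₁, hU₁', hU₂, hU₂',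
    fun i => ?_, fun i => ?_, ?_⟩
  · simp [hd, hd₁, hd₂]
  · simp [hd₁, hd₂]
  · rw [Matrix.mul_inv_rev, Matrix.mul_inv_rev, hinv _ hd₁, hinv _ hd₂]
    refine Prod.ext ?_ ?_
    · have e : permMat π * Matrix.diagonal (d₁ ∘ π.symm) = Matrix.diagonal d₁ * permMat π := by
        rw [permMat_mul_diagonal, Function.comp_assoc, Equiv.symm_comp_self, Function.comp_id]
      simp only [diagonal_pi_mul, ← Matrix.mul_assoc]
      rw [Matrix.mul_assoc U₁ (permMat π), e]
      simp only [Matrix.mul_assoc]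
    · have e : Matrix.diagonal ((d * d₁⁻¹) ∘ π.symm) * permMat π⁻¹ =
          permMat π⁻¹ * (Matrix.diagonal d * Matrix.diagonal d₁⁻¹) := by
        rw [← diagonal_pi_mul]
        exact (permMat_mul_diagonal π⁻¹ (d * d₁⁻¹)).symm
      simp only
      rw [diagonal_pi_mul d₂, ← Matrix.mul_assoc U₂,
        Matrix.mul_assoc _ (Matrix.diagonal (_ ∘ _)) (permMat π⁻¹), e]
      simp only [Matrix.mul_assoc]

theorem mem_torusFamily_of_generic {n : ℕ} (π : Equiv.Perm (Fin n)) {B₁ B₂ A : MatC n}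
    (h₁ : IsUpperTri B₁) (u₁ : IsUnit B₁) (h₂ : IsUpperTri B₂) (u₂ : IsUnit B₂)
    (hA : IsUpperTri A) (hA' : IsUpperTri (permMat π⁻¹ * A * permMat π))
    (h0 : ∀ i, A i i ≠ 0) (hinj : Function.Injective fun i => A i i) :
    (B₁ * permMat π * B₂, B₂⁻¹ * permMat π⁻¹ * A * B₁⁻¹) ∈ torusFamily π := by
  obtain ⟨W, hW1, hWr, hAW⟩ := exists_unipotent_mul_diagonal (A := A)
    (r := fun i j => i ≤ j ∧ π i ≤ π j) (fun i => ⟨le_rfl, le_rfl⟩)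
    (fun i j k h h' => ⟨h.1.trans h'.1, h.2.trans h'.2⟩) (fun i j h => h.1)
    (fun i j h => ⟨not_lt.mp fun h' => h (hA _ _ h'), not_lt.mp fun h' => h (by
      have := hA' _ _ h'
      rw [permMat_mul, mul_permMat] at this
      simpa using this)⟩) hinj
  have hWu : IsUpperTri W := fun i j h => by
    by_contra h'
    exact absurd (hWr _ _ h').1 (not_le.mpr h)
  have uW : IsUnit W := hWu.isUnit_iff.mpr fun i => by simp [hW1]
  set V : MatC n := permMat π⁻¹ * W * permMat π with hV
  have hVe : ∀ i j, V i j = W (π.symm i) (π.symm j) := fun i j => by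
    rw [hV, permMat_mul, mul_permMat]; rfl
  have hVu : IsUpperTri V := fun i j h => by
    rw [hVe]
    by_contra h'
    have := (hWr _ _ h').2
    simp only [Equiv.apply_symm_apply] at this
    exact absurd this (not_le.mpr h)
  have uV : IsUnit V := hVu.isUnit_iff.mpr fun i => by simp [hVe, hW1]
  have hPV : permMat π * V = W * permMat π := by
    rw [hV, ← Matrix.mul_assoc, ← Matrix.mul_assoc, permMat_mul_inv, Matrix.one_mul]
  have hVQ : V * permMat π⁻¹ = permMat π⁻¹ * W := by
    rw [hV, Matrix.mul_assoc, permMat_mul_inv, Matrix.mul_one]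
  have uB₂' : IsUnit B₂⁻¹ := Matrix.isUnit_nonsing_inv_iff.mpr u₂
  convert mem_torusFamily_of_borel π (h₁.mul hWu) (u₁.mul uW) ((h₂.inv u₂).mul hVu)
    (uB₂'.mul uV) h0 using 2
  · rw [Matrix.mul_inv_rev, Matrix.nonsing_inv_nonsing_inv _
      ((Matrix.isUnit_iff_isUnit_det _).mp u₂)]
    calc _ = B₁ * permMat π * (V * V⁻¹) * B₂ := by
          rw [Matrix.mul_inv_of_isUnit uV, Matrix.mul_one]
      _ = B₁ * (permMat π * V) * V⁻¹ * B₂ := by simp only [Matrix.mul_assoc]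
      _ = _ := by rw [hPV]; simp only [Matrix.mul_assoc]
  · rw [Matrix.mul_inv_rev]
    calc _ = B₂⁻¹ * permMat π⁻¹ * (A * (W * W⁻¹)) * B₁⁻¹ := by
          rw [Matrix.mul_inv_of_isUnit uW, Matrix.mul_one]
      _ = B₂⁻¹ * permMat π⁻¹ * (A * W * W⁻¹) * B₁⁻¹ := by simp only [Matrix.mul_assoc]
      _ = B₂⁻¹ * (permMat π⁻¹ * W) * Matrix.diagonal (fun i => A i i) * W⁻¹ * B₁⁻¹ := by
          rw [hAW]; simp only [Matrix.mul_assoc]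
      _ = _ := by rw [← hVQ]; simp only [Matrix.mul_assoc]

/-- A polynomial vanishing at infinitely many points of a line vanishes at its base point. -/
theorem evalPt_eq_zero_of_infinite {n : ℕ} (f : PolyRing n) (X Y Y' : MatC n)
    (h : {c : ℂ | evalPt n (X, Y + c • Y') f = 0}.Infinite) : evalPt n (X, Y) f = 0 := by
  let g : Polynomial ℂ := MvPolynomial.eval₂Hom Polynomial.C
    (Sum.elim (fun q => Polynomial.C (X q.1 q.2))
      (fun q => Polynomial.C (Y q.1 q.2) + Polynomial.X * Polynomial.C (Y' q.1 q.2))) f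
  have key : ∀ c : ℂ, g.eval c = evalPt n (X, Y + c • Y') f := fun c => by
    have : (Polynomial.evalRingHom c).comp (MvPolynomial.eval₂Hom Polynomial.C
        (Sum.elim (fun q => Polynomial.C (X q.1 q.2))
          (fun q => Polynomial.C (Y q.1 q.2) + Polynomial.X * Polynomial.C (Y' q.1 q.2)))) =
        evalPt n (X, Y + c • Y') := by
      refine MvPolynomial.ringHom_ext (fun a => ?_) ?_
      · simp [evalPt]
      · rintro (q | q)
        · simp [evalPt]
        · simp [evalPt, mul_comm c]
    exact congrArg (fun φ : PolyRing n →+* ℂ => φ f) this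
  have hg : g = 0 := Polynomial.eq_zero_of_infinite_isRoot g (h.mono fun c hc => by
    rw [Set.mem_ofPred_eq, Polynomial.IsRoot, key]; exact hc)
  have := key 0
  rw [hg] at this
  simpa using this.symm

theorem infinite_generic_shift {n : ℕ} (a : Fin n → ℂ) :
    {c : ℂ | (∀ i, a i + c * ((i : ℕ) + 1) ≠ 0) ∧
      Function.Injective fun i : Fin n => a i + c * ((i : ℕ) + 1)}.Infinite := by
  have hfin : ((⋃ i : Fin n, {c : ℂ | a i + c * ((i : ℕ) + 1) = 0}) ∪
      ⋃ (i : Fin n) (j : Fin n) (_ : i ≠ j),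
        {c : ℂ | a i + c * ((i : ℕ) + 1) = a j + c * ((j : ℕ) + 1)}).Finite := by
    refine (Set.finite_iUnion fun i => Set.Subsingleton.finite ?_).union
      (Set.finite_iUnion fun i => Set.finite_iUnion fun j => Set.finite_iUnion fun hij =>
        Set.Subsingleton.finite ?_)
    · intro c hc c' hc'
      simp only [Set.mem_ofPred_eq] at hc hc'
      have : ((i : ℕ) : ℂ) + 1 ≠ 0 := Nat.cast_add_one_ne_zero _
      exact mul_right_cancel₀ this (by linear_combination hc - hc')
    · intro c hc c' hc'
      simp only [Set.mem_ofPred_eq] at hc hc'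
      have : ((i : ℕ) : ℂ) - (j : ℕ) ≠ 0 := by
        rw [sub_ne_zero]
        exact_mod_cast fun h => hij (Fin.ext h)
      exact mul_right_cancel₀ this (by linear_combination hc - hc')
  refine hfin.infinite_compl.mono fun c hc => ?_
  simp only [Set.mem_compl_iff, Set.mem_union, Set.mem_iUnion, Set.mem_ofPred_eq, not_or,
    not_exists] at hc
  refine ⟨hc.1, fun i j h => ?_⟩
  by_contra hij
  exact hc.2 i j hij h

theorem evalPt_eq_zero_of_mem_Epi {n : ℕ} {π : Equiv.Perm (Fin n)} {f : PolyRing n}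
    (hf : ∀ p ∈ torusFamily π, evalPt n p f = 0) {p : MatC n × MatC n} (hp : p ∈ Epi π) :
    evalPt n p f = 0 := by
  obtain ⟨X, Y⟩ := p
  obtain ⟨⟨B₁, B₂, u₁, h₁, u₂, h₂, hX⟩, hXY, hYX⟩ := hp
  simp only at hX hXY hYX
  subst hX
  set A : MatC n := permMat π * B₂ * Y * B₁ with hA
  set D : MatC n := Matrix.diagonal fun i => ((i : ℕ) : ℂ) + 1 with hD
  have hAu : IsUpperTri A := by
    have : A = B₁⁻¹ * (B₁ * permMat π * B₂ * Y) * B₁ := by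
      simp only [← Matrix.mul_assoc, Matrix.inv_mul_of_isUnit u₁, Matrix.one_mul, hA]
    exact this ▸ ((h₁.inv u₁).mul hXY).mul h₁
  have hAu' : IsUpperTri (permMat π⁻¹ * A * permMat π) := by
    have : permMat π⁻¹ * A * permMat π = B₂ * (Y * (B₁ * permMat π * B₂)) * B₂⁻¹ := by
      simp only [hA, ← Matrix.mul_assoc, permMat_inv_mul, Matrix.one_mul]
      rw [Matrix.mul_assoc _ B₂ B₂⁻¹, Matrix.mul_inv_of_isUnit u₂, Matrix.mul_one]
    exact this ▸ (h₂.mul hYX).mul (h₂.inv u₂)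
  have hD' : IsUpperTri (permMat π⁻¹ * D * permMat π) := by
    rw [hD, permMat_mul_diagonal, Matrix.mul_assoc, permMat_inv_mul, Matrix.mul_one]
    exact isUpperTri_diagonal _
  have hY : Y = B₂⁻¹ * permMat π⁻¹ * A * B₁⁻¹ := by
    calc Y = (B₂⁻¹ * B₂) * Y * (B₁ * B₁⁻¹) := by
          rw [Matrix.inv_mul_of_isUnit u₂, Matrix.mul_inv_of_isUnit u₁, Matrix.one_mul,
            Matrix.mul_one]
      _ = B₂⁻¹ * (permMat π⁻¹ * permMat π) * B₂ * Y * (B₁ * B₁⁻¹) := by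
          rw [permMat_inv_mul, Matrix.mul_one]
      _ = _ := by simp only [hA, Matrix.mul_assoc]
  refine evalPt_eq_zero_of_infinite f _ _ (B₂⁻¹ * permMat π⁻¹ * D * B₁⁻¹)
    ((infinite_generic_shift fun i => A i i).mono fun c hc => hf _ ?_)
  have hYc : Y + c • (B₂⁻¹ * permMat π⁻¹ * D * B₁⁻¹) =
      B₂⁻¹ * permMat π⁻¹ * (A + c • D) * B₁⁻¹ := by
    rw [Matrix.mul_add, Matrix.add_mul, ← hY, Matrix.mul_smul, Matrix.smul_mul]
  have hdiag : ∀ i, (A + c • D) i i = A i i + c * ((i : ℕ) + 1) := fun i => by simp [hD]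
  rw [hYc]
  refine mem_torusFamily_of_generic π h₁ u₁ h₂ u₂ (fun i j hij => ?_) (fun i j hij => ?_)
    (fun i => hdiag i ▸ hc.1 i) (by simpa only [hdiag] using hc.2)
  · simp [hAu i j hij, hD, hij.ne']
  · rw [Matrix.mul_add, Matrix.add_mul, Matrix.mul_smul, Matrix.smul_mul, Matrix.add_apply,
      Matrix.smul_apply, hAu' i j hij, hD' i j hij, smul_zero, add_zero]

theorem mem_vanishingIdeal {n : ℕ} {S : Set (MatC n × MatC n)} {f : PolyRing n} :
    f ∈ vanishingIdeal n S ↔ ∀ p ∈ S, evalPt n p f = 0 := by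
  simp [vanishingIdeal, Submodule.mem_iInf, RingHom.mem_ker]

/-- The set `T_π = {(U₁P_πtU₂⁻¹, U₂sP_{π⁻¹}U₁⁻¹) : U₁, U₂ ∈ N₊, s, t invertible
diagonal}` is Zariski dense in `E_π`: the two sets have the same vanishing
ideal. -/
theorem stmt17 (n : ℕ) (hn : 1 ≤ n) (π : Equiv.Perm (Fin n)) :
    vanishingIdeal n
      { p : MatC n × MatC n | ∃ (U₁ U₂ : MatC n) (ds dt : Fin n → ℂ),
          IsUpperTri U₁ ∧ (∀ i, U₁ i i = 1) ∧
          IsUpperTri U₂ ∧ (∀ i, U₂ i i = 1) ∧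
          (∀ i, ds i ≠ 0) ∧ (∀ i, dt i ≠ 0) ∧
          p = (U₁ * permMat π * Matrix.diagonal dt * U₂⁻¹,
               U₂ * Matrix.diagonal ds * permMat π⁻¹ * U₁⁻¹) } =
      vanishingIdeal n (Epi π) := by
  ext f
  rw [mem_vanishingIdeal, mem_vanishingIdeal]
  exact ⟨fun hf p hp => evalPt_eq_zero_of_mem_Epi (π := π) hf hp,
    fun hf p hp => hf p (torusFamily_subset_Epi π hp)⟩
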